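/- arXiv:1104.5297 — 2 statements merged into one kernel-verified Lean document; each statement's English description precedes it below -/
import Mathlib

section
/- In a Pólya urn started with b black and w white balls, the fraction of black balls B_n/(b+w+n) converges almost surely as n → ∞ to a random variable Z whose distribution is Beta(b, w). -/
open MeasureTheory ProbabilityTheory Filter

/-- The density of the Beta(b,w) distribution. -/
noncomputable def betaDensity (b w : ℕ) (p : ℝ) : ℝ :=
  Real.Gamma (b + w) / (Real.Gamma b * Real.Gamma w) * p ^ (b - 1) * (1 - p) ^ (w - 1)

/-- The CDF of the Beta(b,w) distribution. -/
noncomputable def betaCDF (b w : ℕ) (x : ℝ) : ℝ :=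
  ∫ p in Set.Ioo (0 : ℝ) x, betaDensity b w p

/-- The event that the first draws are exactly the sequence `ε` (`true` = black). -/
def drawsEq {Ω : Type*} (X : ℕ → Ω → Bool) (ε : List Bool) : Set Ω :=
  {ω | List.ofFn (fun i : Fin ε.length => X (i : ℕ) ω) = ε}

/-- `X` is the draw process of a Pólya urn started with `b` black and `w` white balls:
given any history `ε` of draws, the next ball drawn is black with probability
(current number of black balls)/(current total number of balls). -/
def IsPolyaUrn {Ω : Type*} [MeasurableSpace Ω] (P : Measure Ω)
    (X : ℕ → Ω → Bool) (b w : ℕ) : Prop :=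
  (∀ i, Measurable (X i)) ∧
  ∀ ε : List Bool,
    P (drawsEq X (ε ++ [true])) =
      ENNReal.ofReal (((b : ℝ) + ε.count true) / ((b : ℝ) + w + ε.length)) *
        P (drawsEq X ε)

/-- Number of black balls in the urn after `n` draws. -/
def blackCount {Ω : Type*} (X : ℕ → Ω → Bool) (b n : ℕ) (ω : Ω) : ℕ :=
  b + ((Finset.range n).filter fun i => X i ω = true).card

/-- Number of white balls in the urn after `n` draws. -/
def whiteCount {Ω : Type*} (X : ℕ → Ω → Bool) (w n : ℕ) (ω : Ω) : ℕ :=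
  w + ((Finset.range n).filter fun i => X i ω = false).card

/-- The list of the first `n` draws. -/
def polyaHist {Ω : Type*} (X : ℕ → Ω → Bool) (n : ℕ) (ω : Ω) : List Bool :=
  List.ofFn (fun i : Fin n => X (i : ℕ) ω)

lemma polyaHist_length {Ω : Type*} (X : ℕ → Ω → Bool) (n : ℕ) (ω : Ω) :
    (polyaHist X n ω).length = n := by simp [polyaHist]

lemma polyaHist_succ {Ω : Type*} (X : ℕ → Ω → Bool) (n : ℕ) (ω : Ω) :
    polyaHist X (n + 1) ω = polyaHist X n ω ++ [X n ω] := by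
  unfold polyaHist
  rw [List.ofFn_succ_last]
  simp

lemma drawsEq_eq {Ω : Type*} (X : ℕ → Ω → Bool) (ε : List Bool) :
    drawsEq X ε = polyaHist X ε.length ⁻¹' {ε} := rfl

lemma polyaHist_measurable {Ω : Type*} [MeasurableSpace Ω] {X : ℕ → Ω → Bool}
    (hX : ∀ i, Measurable (X i)) (n : ℕ) :
    @Measurable Ω (List Bool) _ ⊤ (polyaHist X n) := by
  letI : MeasurableSpace (List Bool) := ⊤
  have h1 : Measurable (fun (v : Fin n → Bool) => List.ofFn v) := measurable_of_countable _
  exact h1.comp (measurable_pi_lambda _ fun i => hX i)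

lemma blackCount_eq {Ω : Type*} (X : ℕ → Ω → Bool) (b n : ℕ) (ω : Ω) :
    blackCount X b n ω = b + (polyaHist X n ω).count true := by
  unfold blackCount
  congr 1
  induction n with
  | zero => simp [polyaHist]
  | succ n ih =>
    rw [polyaHist_succ, List.count_append, ← ih, Finset.range_add_one, Finset.filter_insert]
    cases h : X n ω <;> simp

/-- The filtration generated by the draws. -/
def polyaFiltration {Ω : Type*} [m : MeasurableSpace Ω] (X : ℕ → Ω → Bool)
    (hX : ∀ i, Measurable (X i)) : Filtration ℕ m where
  seq n := MeasurableSpace.comap (polyaHist X n) ⊤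
  mono' := by
    refine monotone_nat_of_le_succ fun n => ?_
    rintro _ ⟨T, -, rfl⟩
    refine ⟨{l | l.dropLast ∈ T}, trivial, ?_⟩
    ext ω
    simp [polyaHist_succ]
  le' n := (polyaHist_measurable hX n).comap_le

lemma polyaHist_drawsEq_succ {Ω : Type*} (X : ℕ → Ω → Bool) (ε : List Bool) (c : Bool) :
    drawsEq X (ε ++ [c]) = drawsEq X ε ∩ X ε.length ⁻¹' {c} := by
  ext ω
  rw [drawsEq_eq, drawsEq_eq, List.length_append, List.length_singleton]
  simp only [Set.mem_preimage, Set.mem_singleton_iff, polyaHist_succ, Set.mem_inter_iff]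
  constructor
  · intro h
    have := List.append_inj' h rfl
    simpa using this
  · rintro ⟨h1, h2⟩; rw [h1, h2]

lemma drawsEq_measurableSet {Ω : Type*} [MeasurableSpace Ω] {X : ℕ → Ω → Bool}
    (hX : ∀ i, Measurable (X i)) (ε : List Bool) : MeasurableSet (drawsEq X ε) := by
  rw [drawsEq_eq]
  exact polyaHist_measurable hX _ trivial

lemma polya_integrable {Ω : Type*} [MeasurableSpace Ω] (P : Measure Ω)
    [IsProbabilityMeasure P] {X : ℕ → Ω → Bool} (hX : ∀ i, Measurable (X i))
    (g : List Bool → ℝ) (C : ℝ) (hg : ∀ ε, |g ε| ≤ C) (n : ℕ) :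
    Integrable (fun ω => g (polyaHist X n ω)) P := by
  letI : MeasurableSpace (List Bool) := ⊤
  have h1 : Measurable g := measurable_from_top
  exact Integrable.of_bound (h1.comp (polyaHist_measurable hX n)).aestronglyMeasurable C
    (ae_of_all _ fun ω => hg _)

lemma polya_step {Ω : Type*} [MeasurableSpace Ω] (P : Measure Ω)
    [IsProbabilityMeasure P] {X : ℕ → Ω → Bool} {b w : ℕ} (hb : 1 ≤ b)
    (hX : IsPolyaUrn P X b w) (g : List Bool → ℝ) (C : ℝ) (hg : ∀ ε, |g ε| ≤ C)
    (hh : ∀ ε : List Bool, ((b : ℝ) + ε.count true) / ((b : ℝ) + w + ε.length) * g (ε ++ [true]) +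
      (1 - ((b : ℝ) + ε.count true) / ((b : ℝ) + w + ε.length)) * g (ε ++ [false]) = g ε)
    (ε : List Bool) :
    ∫ ω in drawsEq X ε, g (polyaHist X ε.length ω) ∂P =
      ∫ ω in drawsEq X ε, g (polyaHist X (ε.length + 1) ω) ∂P := by
  have hm := drawsEq_measurableSet hX.1
  have key : ∀ δ : List Bool, ∫ ω in drawsEq X δ, g (polyaHist X δ.length ω) ∂P
      = P.real (drawsEq X δ) * g δ := by
    intro δ
    rw [setIntegral_congr_fun (g := fun _ => g δ) (hm δ)]
    · simp
    · intro ω hω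
      have : polyaHist X δ.length ω = δ := hω
      simp [this]
  have hun : drawsEq X ε = drawsEq X (ε ++ [true]) ∪ drawsEq X (ε ++ [false]) := by
    rw [polyaHist_drawsEq_succ, polyaHist_drawsEq_succ]
    ext ω
    cases h : X ε.length ω <;> simp [h]
  have hdj : Disjoint (drawsEq X (ε ++ [true])) (drawsEq X (ε ++ [false])) := by
    rw [polyaHist_drawsEq_succ, polyaHist_drawsEq_succ, Set.disjoint_left]
    rintro ω ⟨_, h1⟩ ⟨_, h2⟩
    simp at h1 h2
    simp [h1] at h2
  have ht : P.real (drawsEq X (ε ++ [true])) =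
      ((b : ℝ) + ε.count true) / ((b : ℝ) + w + ε.length) * P.real (drawsEq X ε) := by
    rw [measureReal_def, hX.2 ε, ENNReal.toReal_mul, ENNReal.toReal_ofReal (by positivity)]
    rfl
  have hs : P.real (drawsEq X ε) =
      P.real (drawsEq X (ε ++ [true])) + P.real (drawsEq X (ε ++ [false])) := by
    conv_lhs => rw [hun]
    exact measureReal_union hdj (hm _)
  have hi := polya_integrable P hX.1 g C hg (ε.length + 1)
  have k1 := key (ε ++ [true])
  have k2 := key (ε ++ [false])
  rw [List.length_append, List.length_singleton] at k1 k2
  rw [key]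
  conv_rhs => rw [hun]
  rw [setIntegral_union hdj (hm _) hi.integrableOn hi.integrableOn, k1, k2]
  rw [ht] at hs ⊢
  have hf : P.real (drawsEq X (ε ++ [false])) =
    (1 - ((b : ℝ) + ε.count true) / ((b : ℝ) + w + ε.length)) * P.real (drawsEq X ε) := by
    linarith
  rw [hf, ← hh ε]
  ring

lemma polya_martingale {Ω : Type*} [MeasurableSpace Ω] (P : Measure Ω)
    [IsProbabilityMeasure P] {X : ℕ → Ω → Bool} {b w : ℕ} (hb : 1 ≤ b)
    (hX : IsPolyaUrn P X b w) (g : List Bool → ℝ) (C : ℝ) (hg : ∀ ε, |g ε| ≤ C)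
    (hh : ∀ ε : List Bool, ((b : ℝ) + ε.count true) / ((b : ℝ) + w + ε.length) * g (ε ++ [true]) +
      (1 - ((b : ℝ) + ε.count true) / ((b : ℝ) + w + ε.length)) * g (ε ++ [false]) = g ε) :
    Martingale (fun n ω => g (polyaHist X n ω)) (polyaFiltration X hX.1) P := by
  have hi := polya_integrable P hX.1 g C hg
  refine martingale_of_setIntegral_eq_succ ?_ hi ?_
  · intro n
    letI : MeasurableSpace (List Bool) := ⊤
    have h1 : Measurable g := measurable_from_top
    have h2 : Measurable[polyaFiltration X hX.1 n] (polyaHist X n) :=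
      comap_measurable _
    exact (h1.comp h2).stronglyMeasurable
  · rintro n _ ⟨T, -, rfl⟩
    have hT : polyaHist X n ⁻¹' T = ⋃ ε : T, polyaHist X n ⁻¹' {ε.1} := by
      ext ω; simp
    have hms : ∀ ε : T, MeasurableSet (polyaHist X n ⁻¹' {ε.1}) := fun ε =>
      polyaHist_measurable hX.1 n trivial
    have hd : Pairwise (Function.onFun Disjoint fun ε : T => polyaHist X n ⁻¹' {ε.1}) := by
      intro x y hxy
      refine Disjoint.preimage _ ?_
      simpa [Subtype.ext_iff] using hxy
    rw [hT, integral_iUnion hms hd (hi n).integrableOn,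
      integral_iUnion hms hd (hi (n + 1)).integrableOn]
    refine tsum_congr fun ε => ?_
    by_cases hl : ε.1.length = n
    · subst hl
      exact polya_step P hb hX g C hg hh ε.1
    · have : polyaHist X n ⁻¹' {ε.1} = ∅ := by
        ext ω
        simp only [Set.mem_preimage, Set.mem_singleton_iff, Set.mem_empty_iff_false, iff_false]
        intro h
        exact hl (by rw [← h, polyaHist_length])
      simp [this]

/-- The rising factorial functional of the history. -/
noncomputable def polyaG (b w k : ℕ) (ε : List Bool) : ℝ :=
  ∏ j ∈ Finset.range k, ((b : ℝ) + ε.count true + j) / ((b : ℝ) + w + ε.length + j)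

lemma polya_prod_shift (s : ℝ) (k : ℕ) :
    s * ∏ j ∈ Finset.range k, (s + 1 + j) = (∏ j ∈ Finset.range k, (s + j)) * (s + k) := by
  rw [← Finset.prod_range_succ (fun j : ℕ => s + (j : ℝ)), Finset.prod_range_succ', mul_comm]
  congr 1
  · refine Finset.prod_congr rfl fun j _ => ?_
    push_cast; ring
  · simp

lemma polyaG_harm (b w k : ℕ) (hb : 1 ≤ b) (ε : List Bool) :
    ((b : ℝ) + ε.count true) / ((b : ℝ) + w + ε.length) * polyaG b w k (ε ++ [true]) +
      (1 - ((b : ℝ) + ε.count true) / ((b : ℝ) + w + ε.length)) * polyaG b w k (ε ++ [false])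
      = polyaG b w k ε := by
  have hb' : (1 : ℝ) ≤ b := by exact_mod_cast hb
  unfold polyaG
  simp only [Finset.prod_div_distrib, List.count_append, List.length_append]
  simp only [List.count_singleton, List.length_singleton]
  push_cast
  set s : ℝ := (b : ℝ) + ε.count true with hs
  have hspos : 0 < s := by positivity
  set t : ℝ := (b : ℝ) + w + ε.length with ht
  have htpos : 0 < t := by positivity
  have e1 : ∀ a : ℝ, (b : ℝ) + (ε.count true + a) = s + a := fun a => by rw [hs]; ring
  have e2 : ∀ a : ℝ, (b : ℝ) + w + (ε.length + a) = t + a := fun a => by rw [ht]; ring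
  simp only [e1, e2]
  simp
  have p1 := polya_prod_shift s k
  have p2 := polya_prod_shift t k
  have q1 : 0 < ∏ j ∈ Finset.range k, (t + 1 + j) := Finset.prod_pos fun j _ => by positivity
  have q2 : 0 < ∏ j ∈ Finset.range k, (t + j) := Finset.prod_pos fun j _ => by positivity
  set A := ∏ j ∈ Finset.range k, (t + 1 + j)
  set B := ∏ j ∈ Finset.range k, (t + j)
  set D := ∏ j ∈ Finset.range k, (s + 1 + j)
  set E := ∏ j ∈ Finset.range k, (s + j)
  have : s / t * (D / A) + (1 - s / t) * (E / A) = (s * D + (t - s) * E) / (t * A) := by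
    field_simp
  rw [this, p1, p2]
  have : 0 < t + k := by positivity
  field_simp
  ring

lemma polyaG_factor (b w j : ℕ) (hb : 1 ≤ b) (ε : List Bool) :
    0 ≤ ((b : ℝ) + ε.count true + j) / ((b : ℝ) + w + ε.length + j) ∧
    ((b : ℝ) + ε.count true + j) / ((b : ℝ) + w + ε.length + j) ≤ 1 := by
  have hb' : (1 : ℝ) ≤ b := by exact_mod_cast hb
  have h : (ε.count true : ℝ) ≤ ε.length := by exact_mod_cast List.count_le_length
  refine ⟨by positivity, ?_⟩
  have : (0 : ℝ) ≤ w := by positivity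
  rw [div_le_one (by positivity)]
  linarith

lemma polyaG_bound (b w k : ℕ) (hb : 1 ≤ b) (ε : List Bool) : |polyaG b w k ε| ≤ 1 := by
  unfold polyaG
  rw [abs_of_nonneg (Finset.prod_nonneg fun j _ => (polyaG_factor b w j hb ε).1)]
  exact Finset.prod_le_one (fun j _ => (polyaG_factor b w j hb ε).1)
    (fun j _ => (polyaG_factor b w j hb ε).2)

lemma betaDensity_eq (b w : ℕ) (hb : 1 ≤ b) (hw : 1 ≤ w) (p : ℝ) :
    (Set.Ioo (0 : ℝ) 1).indicator (betaDensity b w) p = betaPDFReal b w p := by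
  unfold betaPDFReal
  by_cases h : 0 < p ∧ p < 1
  · rw [if_pos h, Set.indicator_of_mem (by exact h), betaDensity, beta]
    have e1 : (b : ℝ) - 1 = ((b - 1 : ℕ) : ℝ) := by push_cast [hb]; ring
    have e2 : (w : ℝ) - 1 = ((w - 1 : ℕ) : ℝ) := by push_cast [hw]; ring
    rw [e1, e2, Real.rpow_natCast, Real.rpow_natCast, one_div_div]
  · rw [if_neg h, Set.indicator_of_notMem (by exact h)]

lemma integral_betaPDFReal {α β : ℝ} (hα : 0 < α) (hβ : 0 < β) :
    ∫ x, betaPDFReal α β x = 1 := by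
  rw [integral_eq_lintegral_of_nonneg_ae]
  · have := lintegral_betaPDF_eq_one hα hβ
    unfold betaPDF at this
    rw [this]; simp
  · refine ae_of_all _ fun x => ?_
    by_cases h : 0 < x ∧ x < 1
    · exact (betaPDFReal_pos h.1 h.2 hα hβ).le
    · simp [betaPDFReal, h]
  · exact (measurable_betaPDFReal α β).aestronglyMeasurable

lemma betaPDFReal_nonneg' {α β : ℝ} (hα : 0 < α) (hβ : 0 < β) (x : ℝ) :
    0 ≤ betaPDFReal α β x := by
  by_cases h : 0 < x ∧ x < 1
  · exact (betaPDFReal_pos h.1 h.2 hα hβ).le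
  · simp [betaPDFReal, h]

lemma beta_ratio {α β : ℝ} (hα : 0 < α) (hβ : 0 < β) (k : ℕ) :
    beta (α + k) β / beta α β = ∏ j ∈ Finset.range k, (α + j) / (α + β + j) := by
  induction k with
  | zero => simp [(beta_pos hα hβ).ne']
  | succ k ih =>
    rw [Finset.prod_range_succ, ← ih]
    have h1 : 0 < α + k := by positivity
    have h2 : 0 < α + β + k := by positivity
    have h3 : 0 < α + k + β := by positivity
    unfold beta
    push_cast
    rw [show α + (k + 1 : ℝ) = α + k + 1 by ring, show α + k + 1 + β = α + k + β + 1 by ring,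
      Real.Gamma_add_one h1.ne', Real.Gamma_add_one h3.ne',
      show α + k + β = α + β + k by ring]
    have g1 := (Real.Gamma_pos_of_pos h1).ne'
    have g2 := (Real.Gamma_pos_of_pos h2).ne'
    have g3 := (Real.Gamma_pos_of_pos hα).ne'
    have g4 := (Real.Gamma_pos_of_pos hβ).ne'
    have g5 := (Real.Gamma_pos_of_pos (add_pos hα hβ)).ne'
    field_simp

lemma betaMeasure_moment {α β : ℝ} (hα : 0 < α) (hβ : 0 < β) (k : ℕ) :
    ∫ x, x ^ k ∂(betaMeasure α β) = ∏ j ∈ Finset.range k, (α + j) / (α + β + j) := by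
  have hk : 0 < α + k := by positivity
  unfold betaMeasure
  rw [integral_withDensity_eq_integral_toReal_smul]
  · rw [← beta_ratio hα hβ, ← mul_one (_ / _), ← integral_betaPDFReal hk hβ, ← integral_const_mul]
    congr 1
    ext x
    rw [betaPDF, ENNReal.toReal_ofReal (betaPDFReal_nonneg' hα hβ x), smul_eq_mul]
    unfold betaPDFReal
    split_ifs with h
    · rw [show α + k - 1 = (α - 1) + k by ring, Real.rpow_add h.1, Real.rpow_natCast]
      have := (beta_pos hα hβ).ne'
      have := (beta_pos hk hβ).ne'
      field_simp
    · simp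
  · exact (measurable_betaPDFReal α β).ennreal_ofReal
  · exact ae_of_all _ fun x => ENNReal.ofReal_lt_top

lemma betaMeasure_support (α β : ℝ) : ∀ᵐ x ∂(betaMeasure α β), x ∈ Set.Icc (0 : ℝ) 1 := by
  unfold betaMeasure
  have hm : Measurable (betaPDF α β) := (measurable_betaPDFReal α β).ennreal_ofReal
  rw [ae_withDensity_iff hm]
  refine ae_of_all _ fun x hx => ?_
  by_contra h
  apply hx
  have : ¬ (0 < x ∧ x < 1) := fun h' => h ⟨h'.1.le, h'.2.le⟩
  simp [betaPDF_eq, this]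

/-- Probability measures on `[0,1]` are determined by their moments. -/
lemma measure_eq_of_moments (μ ν : Measure ℝ) [IsProbabilityMeasure μ] [IsProbabilityMeasure ν]
    (hμ : ∀ᵐ x ∂μ, x ∈ Set.Icc (0 : ℝ) 1) (hν : ∀ᵐ x ∂ν, x ∈ Set.Icc (0 : ℝ) 1)
    (h : ∀ k : ℕ, ∫ x, x ^ k ∂μ = ∫ x, x ^ k ∂ν) : μ = ν := by
  have hint : ∀ (ρ : Measure ℝ) [IsProbabilityMeasure ρ], (∀ᵐ x ∂ρ, x ∈ Set.Icc (0 : ℝ) 1) →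
      ∀ k : ℕ, Integrable (fun x : ℝ => x ^ k) ρ := by
    intro ρ _ hρ k
    refine Integrable.of_bound (by fun_prop) 1 ?_
    filter_upwards [hρ] with x hx
    rw [Real.norm_eq_abs, abs_of_nonneg (pow_nonneg hx.1 _)]
    exact pow_le_one₀ hx.1 hx.2
  have hpi : ∀ (ρ : Measure ℝ) [IsProbabilityMeasure ρ], (∀ᵐ x ∂ρ, x ∈ Set.Icc (0 : ℝ) 1) →
      ∀ p : Polynomial ℝ, Integrable (fun x : ℝ => p.eval x) ρ := by
    intro ρ _ hρ p
    simp_rw [Polynomial.eval_eq_sum_range]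
    exact integrable_finsetSum _ fun i _ => (hint ρ hρ i).const_mul _
  have hpoly : ∀ p : Polynomial ℝ, ∫ x, p.eval x ∂μ = ∫ x, p.eval x ∂ν := by
    intro p
    simp_rw [Polynomial.eval_eq_sum_range]
    rw [integral_finsetSum _ fun i _ => (hint μ hμ i).const_mul _,
      integral_finsetSum _ fun i _ => (hint ν hν i).const_mul _]
    refine Finset.sum_congr rfl fun i _ => ?_
    rw [integral_const_mul, integral_const_mul, h i]
  refine ext_of_forall_integral_eq_of_IsFiniteMeasure fun f => ?_
  have hclose : ∀ (ρ : Measure ℝ) [IsProbabilityMeasure ρ], (∀ᵐ x ∂ρ, x ∈ Set.Icc (0 : ℝ) 1) →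
      ∀ (p : Polynomial ℝ) (e : ℝ), (∀ x ∈ Set.Icc (0 : ℝ) 1, |p.eval x - f x| < e) →
      |∫ x, p.eval x ∂ρ - ∫ x, f x ∂ρ| ≤ e := by
    intro ρ _ hρ p e hp
    rw [← integral_sub (hpi ρ hρ p) (f.integrable ρ)]
    have := norm_integral_le_of_norm_le_const (μ := ρ) (C := e)
      (f := fun x => p.eval x - f x) (by
        filter_upwards [hρ] with x hx
        exact (hp x hx).le)
    simpa using this
  refine eq_of_forall_dist_le fun e he => ?_
  obtain ⟨p, hp⟩ := exists_polynomial_near_of_continuousOn 0 1 f f.continuous.continuousOn (e / 2)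
    (half_pos he)
  have h1 := hclose μ hμ p _ hp
  have h2 := hclose ν hν p _ hp
  rw [hpoly p] at h1
  rw [Real.dist_eq]
  rw [abs_le] at *
  constructor <;> linarith [h1.1, h1.2, h2.1, h2.2]

/-- In a Pólya urn, the fraction of black balls converges almost surely to a
Beta(b,w)-distributed random variable. -/
theorem polya_fraction_tendsto_beta {Ω : Type*} [MeasurableSpace Ω] (P : Measure Ω)
    [IsProbabilityMeasure P] (X : ℕ → Ω → Bool) (b w : ℕ)
    (hb : 1 ≤ b) (hw : 1 ≤ w) (hX : IsPolyaUrn P X b w) :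
    ∃ Z : Ω → ℝ, Measurable Z ∧
      (∀ᵐ ω ∂P, Tendsto (fun n => (blackCount X b n ω : ℝ) / ((b : ℝ) + w + n))
        atTop (nhds (Z ω))) ∧
      Measure.map Z P =
        volume.withDensity fun p =>
          ENNReal.ofReal ((Set.Ioo (0 : ℝ) 1).indicator (betaDensity b w) p) := by
  have hb' : (0 : ℝ) < b := by exact_mod_cast hb
  have hw' : (0 : ℝ) < w := by exact_mod_cast hw
  have hM : ∀ k, Martingale (fun n ω => polyaG b w k (polyaHist X n ω))
      (polyaFiltration X hX.1) P := fun k =>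
    polya_martingale P hb hX (polyaG b w k) 1 (polyaG_bound b w k hb) (polyaG_harm b w k hb)
  have hfrac : ∀ n ω, polyaG b w 1 (polyaHist X n ω) =
      (blackCount X b n ω : ℝ) / ((b : ℝ) + w + n) := by
    intro n ω
    simp [polyaG, blackCount_eq, polyaHist_length]
  have hex := (hM 1).submartingale.exists_ae_tendsto_of_bdd (R := 1) (by
    intro n
    refine (eLpNorm_le_of_ae_bound (C := 1) (ae_of_all _ fun ω => ?_)).trans ?_
    · exact polyaG_bound b w 1 hb _
    · simp)
  obtain ⟨Z, hZm, hconv⟩ := measurable_limit_of_tendsto_metrizable_ae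
    (fun n => ((hM 1).integrable n).aestronglyMeasurable.aemeasurable) hex
  refine ⟨Z, hZm, ?_, ?_⟩
  · filter_upwards [hconv] with ω hω
    simpa only [hfrac] using hω
  have hZs : ∀ᵐ ω ∂P, Z ω ∈ Set.Icc (0 : ℝ) 1 := by
    filter_upwards [hconv] with ω hω
    refine isClosed_Icc.mem_of_tendsto hω (Eventually.of_forall fun n => ?_)
    have := polyaG_factor b w 0 hb (polyaHist X n ω)
    simpa [polyaG] using this
  have hpow : ∀ k, ∀ᵐ ω ∂P, Tendsto (fun n => polyaG b w k (polyaHist X n ω)) atTop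
      (nhds (Z ω ^ k)) := by
    intro k
    filter_upwards [hconv] with ω hω
    have : Z ω ^ k = ∏ j ∈ Finset.range k, Z ω := by simp
    rw [this]
    unfold polyaG
    refine tendsto_finsetProd _ fun j _ => ?_
    have hT : Tendsto (fun n : ℕ => (b : ℝ) + w + n + j) atTop atTop := by
      refine tendsto_atTop_add_const_right _ _ ?_
      exact tendsto_atTop_add_const_left _ _ tendsto_natCast_atTop_atTop
    have h1 : Tendsto (fun n : ℕ => (j : ℝ) / ((b : ℝ) + w + n + j)) atTop (nhds 0) :=
      hT.const_div_atTop _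
    have h2 := (hω.mul ((tendsto_const_nhds (x := (1 : ℝ))).sub h1)).add h1
    simp only [sub_zero, mul_one, add_zero] at h2
    refine h2.congr fun n => ?_
    simp only [polyaG, polyaHist_length, Finset.prod_range_one, Nat.cast_zero, add_zero]
    have t1 : (b : ℝ) + w + n ≠ 0 := by positivity
    have t2 : (b : ℝ) + w + n + j ≠ 0 := by positivity
    field_simp
    ring
  have hmom : ∀ k : ℕ, ∫ ω, Z ω ^ k ∂P =
      ∏ j ∈ Finset.range k, ((b : ℝ) + j) / ((b : ℝ) + w + j) := by
    intro k
    have hlim := tendsto_integral_of_dominated_convergence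
      (F := fun n ω => polyaG b w k (polyaHist X n ω)) (f := fun ω => Z ω ^ k) (μ := P)
      (fun _ => (1 : ℝ)) (fun n => ((hM k).integrable n).aestronglyMeasurable)
      (integrable_const _) (fun n => ae_of_all _ fun ω => polyaG_bound b w k hb _) (hpow k)
    have hc : ∀ n, ∫ ω, polyaG b w k (polyaHist X n ω) ∂P =
        ∏ j ∈ Finset.range k, ((b : ℝ) + j) / ((b : ℝ) + w + j) := by
      intro n
      have := (hM k).setIntegral_eq (Nat.zero_le n) MeasurableSet.univ
      rw [setIntegral_univ, setIntegral_univ] at this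
      rw [← this]
      simp [polyaG, polyaHist]
    simp only [hc] at hlim
    exact tendsto_nhds_unique hlim tendsto_const_nhds |>.symm ▸ rfl
  have hbeta : (volume.withDensity fun p =>
      ENNReal.ofReal ((Set.Ioo (0 : ℝ) 1).indicator (betaDensity b w) p)) =
      betaMeasure b w := by
    simp only [betaDensity_eq b w hb hw]
    rfl
  rw [hbeta]
  haveI := isProbabilityMeasureBeta hb' hw'
  haveI : IsProbabilityMeasure (Measure.map Z P) := Measure.isProbabilityMeasure_map hZm.aemeasurable
  refine measure_eq_of_moments _ _ ?_ (betaMeasure_support _ _) fun k => ?_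
  · exact (ae_map_iff hZm.aemeasurable measurableSet_Icc).2 hZs
  · rw [betaMeasure_moment hb' hw', integral_map hZm.aemeasurable (by fun_prop), hmom]
end

section
/- For a Pólya urn started with b black and w white balls (b > w ≥ 1), let τ be the first time n at which B_n = W_n (possibly infinite) and let μ = 2Z − 1 where Z is the limiting black fraction. Then P(τ < ∞ and μ < 0) = P(τ < ∞ and μ > 0), and hence P(τ < ∞) = 2 P(μ < 0). -/
open MeasureTheory ProbabilityTheory Filter


def bc (b n : ℕ) (x : ℕ → Bool) : ℕ := b + ((Finset.range n).filter fun i => x i = true).card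
def wc (w n : ℕ) (x : ℕ → Bool) : ℕ := w + ((Finset.range n).filter fun i => x i = false).card

lemma bc_succ (b n : ℕ) (x) : bc b (n+1) x = bc b n x + (if x n then 1 else 0) := by
  unfold bc
  rw [Finset.range_add_one, Finset.filter_insert]
  cases h : x n <;> simp [add_assoc]
lemma wc_succ (b n : ℕ) (x) : wc b (n+1) x = wc b n x + (if x n then 0 else 1) := by
  unfold wc
  rw [Finset.range_add_one, Finset.filter_insert]
  cases h : x n <;> simp [add_assoc]
lemma bc_zero (b x) : bc b 0 x = b := by simp [bc]
lemma wc_zero (b x) : wc b 0 x = b := by simp [wc]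
lemma bw_add (b w n x) : bc b n x + wc w n x = b + w + n := by
  induction n with
  | zero => simp [bc_zero, wc_zero]
  | succ n ih => rw [bc_succ, wc_succ]; cases x n <;> simp <;> omega
lemma bc_congr {b n : ℕ} {x y : ℕ → Bool} (h : ∀ i < n, x i = y i) : bc b n x = bc b n y := by
  unfold bc; congr 2; apply Finset.filter_congr; intro i hi; rw [h i (by simpa using hi)]
lemma wc_congr {b n : ℕ} {x y : ℕ → Bool} (h : ∀ i < n, x i = y i) : wc b n x = wc b n y := by
  unfold wc; congr 2; apply Finset.filter_congr; intro i hi; rw [h i (by simpa using hi)]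

def HH (b w n : ℕ) (x : ℕ → Bool) : Prop := ∃ m ≤ n, bc b m x = wc w m x
open Classical in
noncomputable def flp (b w : ℕ) (x : ℕ → Bool) (i : ℕ) : Bool := if HH b w i x then !(x i) else x i

lemma HH_succ {b w n x} : HH b w (n+1) x ↔ HH b w n x ∨ bc b (n+1) x = wc w (n+1) x := by
  unfold HH
  constructor
  · rintro ⟨m, hm, h⟩
    rcases Nat.lt_or_ge m (n+1) with h1 | h1
    · exact Or.inl ⟨m, by omega, h⟩
    · obtain rfl : m = n+1 := by omega
      exact Or.inr h
  · rintro (⟨m, hm, h⟩ | h)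
    · exact ⟨m, by omega, h⟩
    · exact ⟨_, le_rfl, h⟩

lemma flp_counts (b w n x) :
    (HH b w n x → bc b n (flp b w x) = wc w n x ∧ wc w n (flp b w x) = bc b n x) ∧
    (¬ HH b w n x → bc b n (flp b w x) = bc b n x ∧ wc w n (flp b w x) = wc w n x) := by
  induction n with
  | zero =>
    constructor
    · rintro ⟨m, hm, h⟩
      obtain rfl : m = 0 := by omega
      simp [bc_zero, wc_zero] at h ⊢
      omega
    · simp [bc_zero, wc_zero]
  | succ n ih =>
    rw [HH_succ]
    simp only [bc_succ, wc_succ]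
    by_cases h : HH b w n x
    · have := ih.1 h
      have e : flp b w x n = !(x n) := by simp [flp, h]
      simp only [h, e]
      cases x n <;> simp <;> omega
    · have := ih.2 h
      have e : flp b w x n = x n := by simp [flp, h]
      simp only [h, e]
      cases x n <;> simp <;> omega

lemma flp_eq_iff (b w n x) : bc b n (flp b w x) = wc w n (flp b w x) ↔ bc b n x = wc w n x := by
  have := flp_counts b w n x
  by_cases h : HH b w n x
  · have := this.1 h; omega
  · have := this.2 h; omega

lemma HH_flp (b w n x) : HH b w n (flp b w x) ↔ HH b w n x := by
  simp [HH, flp_eq_iff]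

lemma flp_flp (b w x) : flp b w (flp b w x) = x := by
  funext i
  have := HH_flp b w i x
  by_cases h : HH b w i x
  · rw [flp, if_pos (this.2 h), flp, if_pos h, Bool.not_not]
  · rw [flp, if_neg (fun h' => h (this.1 h')), flp, if_neg h]

lemma flp_causal {b w n : ℕ} {x y : ℕ → Bool} (h : ∀ i < n, x i = y i) :
    ∀ i < n, flp b w x i = flp b w y i := by
  intro i hi
  have : HH b w i x ↔ HH b w i y := by
    unfold HH
    apply exists_congr; intro m
    apply and_congr_right; intro hm
    rw [bc_congr (fun j hj => h j (by omega)), wc_congr (fun j hj => h j (by omega))]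
  unfold flp
  by_cases h' : HH b w i x
  · rw [if_pos h', if_pos (this.1 h'), h i hi]
  · rw [if_neg h', if_neg (fun h2 => h' (this.2 h2)), h i hi]

lemma measurable_bc (b n) : Measurable (bc b n) := by
  induction n with
  | zero => simp only [funext (bc_zero b)]; exact measurable_const
  | succ n ih =>
    simp only [funext (bc_succ b n)]
    exact ih.add (Measurable.ite (measurableSet_eq_fun (measurable_pi_apply n) measurable_const) measurable_const measurable_const)
lemma measurable_wc (b n) : Measurable (wc b n) := by
  induction n with
  | zero => simp only [funext (wc_zero b)]; exact measurable_const
  | succ n ih =>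
    simp only [funext (wc_succ b n)]
    exact ih.add (Measurable.ite (measurableSet_eq_fun (measurable_pi_apply n) measurable_const) measurable_const measurable_const)

lemma measurable_E (b w n) : MeasurableSet {x | bc b n x = wc w n x} :=
  measurableSet_eq_fun (measurable_bc b n) (measurable_wc w n)

lemma measurable_HH (b w n) : MeasurableSet {x | HH b w n x} := by
  have : {x | HH b w n x} = ⋃ m ∈ Set.Iic n, {x | bc b m x = wc w m x} := by
    ext x; simp [HH]
  rw [this]
  exact MeasurableSet.biUnion (Set.to_countable _) fun m _ => measurable_E b w m

lemma measurable_flp (b w) : Measurable (flp b w) := by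
  rw [measurable_pi_iff]
  intro i
  unfold flp
  exact Measurable.ite (measurable_HH b w i) ((measurable_of_finite not).comp (measurable_pi_apply i)) (measurable_pi_apply i)

lemma ext_cyl (μ ν : Measure (ℕ → Bool)) [IsProbabilityMeasure μ] [IsProbabilityMeasure ν]
    (h : ∀ (y : ℕ → Bool) n, μ {x | ∀ i < n, x i = y i} = ν {x | ∀ i < n, x i = y i}) : μ = ν := by
  have hb := PiNat.isTopologicalBasis_cylinders (fun _ : ℕ => Bool)
  refine ext_of_generate_finite (insert ∅ {s | ∃ (y : ℕ → Bool) (n : ℕ), s = PiNat.cylinder y n}) ?_ ?_ ?_ (by simp)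
  · rw [MeasurableSpace.generateFrom_insert_empty, ← hb.borel_eq_generateFrom]
    exact BorelSpace.measurable_eq
  · apply IsPiSystem.insert_empty
    rintro _ ⟨y, n, rfl⟩ _ ⟨z, m, rfl⟩ ⟨u, hu1, hu2⟩
    rw [← PiNat.mem_cylinder_iff_eq.1 hu1, ← PiNat.mem_cylinder_iff_eq.1 hu2]
    refine ⟨u, max n m, ?_⟩
    ext v
    simp only [PiNat.cylinder, Set.mem_inter_iff, Set.mem_ofPred_eq]
    constructor
    · rintro ⟨h1, h2⟩ i hi
      rcases lt_max_iff.1 hi with h | h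
      exacts [h1 i h, h2 i h]
    · intro h
      exact ⟨fun i hi => h i (by omega), fun i hi => h i (by omega)⟩
  · rintro s (rfl | ⟨y, n, rfl⟩)
    · simp
    · exact h y n

lemma drawsEq_range {Ω : Type*} (X : ℕ → Ω → Bool) (y : ℕ → Bool) (n : ℕ) :
    drawsEq X ((List.range n).map y) = {ω | ∀ i < n, X i ω = y i} := by
  ext ω
  unfold drawsEq
  simp only [Set.mem_ofPred_eq]
  constructor
  · intro h i hi
    have h2 := congrArg (fun l => l[i]?) h
    simpa [List.getElem?_ofFn, hi] using h2
  · intro h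
    apply List.ext_getElem
    · simp
    · intro i h1 h2
      simp at h1
      simpa using h i h1

lemma count_range (b n : ℕ) (y : ℕ → Bool) : b + ((List.range n).map y).count true = bc b n y := by
  induction n with
  | zero => simp [bc_zero]
  | succ n ih =>
    rw [List.range_succ, List.map_append, List.count_append, bc_succ, ← ih]
    cases h : y n <;> simp [h] <;> omega

section
variable {Ω : Type*} [MeasurableSpace Ω] {P : Measure Ω} [IsProbabilityMeasure P]
  {X : ℕ → Ω → Bool} {b w : ℕ}

lemma meas_cyl (hX : IsPolyaUrn P X b w) (y : ℕ → Bool) (n : ℕ) :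
    MeasurableSet {ω | ∀ i < n, X i ω = y i} := by
  have : {ω | ∀ i < n, X i ω = y i} = ⋂ i ∈ Set.Iio n, {ω | X i ω = y i} := by ext; simp
  rw [this]
  exact MeasurableSet.biInter (Set.to_countable _) fun i _ =>
    measurableSet_eq_fun (hX.1 i) measurable_const

lemma step_true (hX : IsPolyaUrn P X b w) (y : ℕ → Bool) (n : ℕ) :
    P.real ({ω | ∀ i < n, X i ω = y i} ∩ {ω | X n ω = true}) =
      (bc b n y : ℝ) / (b + w + n) * P.real {ω | ∀ i < n, X i ω = y i} := by
  have h := hX.2 ((List.range n).map y)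
  have e : (List.range n).map y ++ [true] = (List.range (n+1)).map (Function.update y n true) := by
    rw [List.range_succ, List.map_append]
    congr 1
    · apply List.map_congr_left
      intro a ha
      simp at ha
      rw [Function.update_of_ne (by omega)]
    · simp
  rw [e, drawsEq_range, drawsEq_range] at h
  have e2 : {ω | ∀ i < n, X i ω = y i} ∩ {ω | X n ω = true} =
      {ω | ∀ i < n + 1, X i ω = Function.update y n true i} := by
    ext ω
    simp only [Set.mem_inter_iff, Set.mem_ofPred_eq]
    constructor
    · rintro ⟨h1, h2⟩ i hi
      by_cases hin : i = n
      · subst hin; simpa using h2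
      · rw [Function.update_of_ne hin]; exact h1 i (by omega)
    · intro h1
      refine ⟨fun i hi => ?_, by simpa using h1 n (by omega)⟩
      have := h1 i (by omega)
      rwa [Function.update_of_ne (by omega)] at this
  rw [e2, measureReal_def, h, ENNReal.toReal_mul, ENNReal.toReal_ofReal (by positivity),
    ← count_range, measureReal_def]
  simp

lemma step_false (hX : IsPolyaUrn P X b w) (hw : 1 ≤ w) (y : ℕ → Bool) (n : ℕ) :
    P.real ({ω | ∀ i < n, X i ω = y i} ∩ {ω | X n ω = false}) =
      (wc w n y : ℝ) / (b + w + n) * P.real {ω | ∀ i < n, X i ω = y i} := by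
  have h := step_true hX y n
  have hm : MeasurableSet {ω | X n ω = true} := measurableSet_eq_fun (hX.1 n) measurable_const
  have h2 := measureReal_inter_add_sdiff (μ := P) (s := {ω | ∀ i < n, X i ω = y i}) hm
  have e : {ω | ∀ i < n, X i ω = y i} \ {ω | X n ω = true} =
    {ω | ∀ i < n, X i ω = y i} ∩ {ω | X n ω = false} := by ext; simp
  rw [e, h] at h2
  have hs : (bc b n y : ℝ) + wc w n y = b + w + n := by exact_mod_cast bw_add b w n y
  have hp : (0:ℝ) < b + w + n := by positivity
  have : (wc w n y : ℝ) / (b + w + n) = 1 - bc b n y / (b + w + n) := by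
    field_simp; linarith
  rw [this]; linarith

noncomputable def wt (B W : ℕ) : ℝ := (Nat.factorial (B-1)) * (Nat.factorial (W-1)) / Nat.factorial (B+W-1)

lemma wt_symm (B W) : wt B W = wt W B := by unfold wt; rw [add_comm W B]; ring

lemma wt_succ_left {B W : ℕ} (hB : 1 ≤ B) : wt (B+1) W = B / (B+W) * wt B W := by
  obtain ⟨B, rfl⟩ : ∃ k, B = k+1 := ⟨B-1, by omega⟩
  unfold wt
  have e1 : B+1+1+W-1 = (B+W)+1 := by omega
  have e2 : B+1+W-1 = B+W := by omega
  rw [e1, e2, Nat.factorial_succ (B+W)]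
  simp only [Nat.add_sub_cancel, Nat.factorial_succ B]
  push_cast
  have : (Nat.factorial (B+W) : ℝ) ≠ 0 := by positivity
  field_simp
  ring

lemma wt_succ_right {B W : ℕ} (hB : 1 ≤ W) : wt B (W+1) = W / (B+W) * wt B W := by
  rw [wt_symm, wt_succ_left hB, wt_symm, add_comm (B:ℝ)]

lemma cyl_wt (hX : IsPolyaUrn P X b w) (hb : 1 ≤ b) (hw : 1 ≤ w) (y : ℕ → Bool) (n : ℕ) :
    P.real {ω | ∀ i < n, X i ω = y i} = wt (bc b n y) (wc w n y) / wt b w := by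
  induction n with
  | zero =>
    have : wt b w ≠ 0 := by unfold wt; positivity
    simp [bc_zero, wc_zero, this]
  | succ n ih =>
    have hs : (bc b n y : ℝ) + wc w n y = b + w + n := by exact_mod_cast bw_add b w n y
    have e : {ω | ∀ i < n+1, X i ω = y i} = {ω | ∀ i < n, X i ω = y i} ∩ {ω | X n ω = y n} := by
      ext ω
      simp only [Set.mem_inter_iff, Set.mem_ofPred_eq]
      exact Nat.forall_lt_succ_right
    have h1 : 1 ≤ bc b n y := by unfold bc; omega
    have h2 : 1 ≤ wc w n y := by unfold wc; omega
    rw [e]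
    cases h : y n
    · rw [step_false hX hw, ih, bc_succ, wc_succ, h]
      simp only [Bool.false_eq_true, if_false, add_zero]
      rw [wt_succ_right h2, hs]; ring
    · rw [step_true hX, ih, bc_succ, wc_succ, h]
      simp only [if_true, add_zero]
      rw [wt_succ_left h1, hs]; ring

lemma map_flp (hX : IsPolyaUrn P X b w) (hb : 1 ≤ b) (hw : 1 ≤ w) :
    P.map (fun ω i => X i ω) = P.map (fun ω => flp b w (fun i => X i ω)) := by
  have hT : Measurable (fun ω i => X i ω) := measurable_pi_iff.2 hX.1
  have hF := (measurable_flp b w).comp hT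
  have := Measure.isProbabilityMeasure_map (μ := P) hT.aemeasurable
  have := Measure.isProbabilityMeasure_map (μ := P) hF.aemeasurable
  refine ext_cyl _ (P.map (flp b w ∘ (fun ω i => X i ω))) fun y n => ?_
  have hm : MeasurableSet {x : ℕ → Bool | ∀ i < n, x i = y i} := by
    have : {x : ℕ → Bool | ∀ i < n, x i = y i} = ⋂ i ∈ Set.Iio n, {x | x i = y i} := by ext; simp
    rw [this]
    exact MeasurableSet.biInter (Set.to_countable _) fun i _ =>
      measurableSet_eq_fun (measurable_pi_apply i) measurable_const
  rw [Measure.map_apply hT hm, Measure.map_apply hF hm]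
  have e : (flp b w ∘ (fun ω i => X i ω)) ⁻¹' {x : ℕ → Bool | ∀ i < n, x i = y i} =
      {ω | ∀ i < n, X i ω = flp b w y i} := by
    ext ω
    simp only [Set.mem_preimage, Set.mem_ofPred_eq, Function.comp]
    constructor
    · intro h
      have := flp_causal (b := b) (w := w) h
      rwa [flp_flp] at this
    · intro h
      have := flp_causal (b := b) (w := w) h
      rwa [flp_flp] at this
  rw [e]
  have key : P.real {ω | ∀ i < n, X i ω = y i} = P.real {ω | ∀ i < n, X i ω = flp b w y i} := by
    rw [cyl_wt hX hb hw, cyl_wt hX hb hw]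
    have := flp_counts b w n y
    by_cases h : HH b w n y
    · rw [(this.1 h).1, (this.1 h).2, wt_symm]
    · rw [(this.2 h).1, (this.2 h).2]
  exact (measureReal_eq_measureReal_iff).1 key

lemma step_k (hX : IsPolyaUrn P X b w) (n : ℕ) (A : Set Ω) (hA : MeasurableSet A) (k : ℕ) (r : ℝ)
    (h : ∀ y, bc b n y = k → P.real ({ω | ∀ i < n, X i ω = y i} ∩ A) =
      r * P.real {ω | ∀ i < n, X i ω = y i}) :
    P.real ({ω | bc b n (fun i => X i ω) = k} ∩ A) = r * P.real {ω | bc b n (fun i => X i ω) = k} := by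
  classical
  let pr : Ω → (Fin n → Bool) := fun ω i => X i ω
  let ex : (Fin n → Bool) → ℕ → Bool := fun e i => if h : i < n then e ⟨i, h⟩ else false
  have hpr : Measurable pr := measurable_pi_iff.2 fun i => hX.1 i
  let S : Finset (Fin n → Bool) := Finset.univ.filter fun e => bc b n (ex e) = k
  have e1 : {ω | bc b n (fun i => X i ω) = k} = pr ⁻¹' S := by
    ext ω
    simp only [S, Set.mem_preimage, Set.mem_ofPred_eq, Finset.coe_filter, Finset.mem_univ, true_and]
    rw [bc_congr (y := ex (pr ω))]
    intro i hi
    simp [ex, pr, hi]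
  have e2 : ∀ e, pr ⁻¹' {e} = {ω | ∀ i < n, X i ω = ex e i} := by
    intro e
    ext ω
    simp only [Set.mem_preimage, Set.mem_singleton_iff, Set.mem_ofPred_eq]
    constructor
    · rintro rfl i hi
      simp [ex, pr, hi]
    · intro h
      funext i
      have := h i i.2
      simpa [ex, pr] using this
  have s1 := sum_measureReal_preimage_singleton (μ := P) S (f := pr) (fun e _ => hpr (measurableSet_singleton e))
  have s2 := sum_measureReal_preimage_singleton (μ := P.restrict A) S (f := pr) (fun e _ => hpr (measurableSet_singleton e))
  rw [e1, ← measureReal_restrict_apply (hpr S.measurableSet), ← s1, ← s2, Finset.mul_sum]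
  refine Finset.sum_congr rfl fun e he => ?_
  rw [measureReal_restrict_apply (hpr (measurableSet_singleton e)), e2]
  exact h _ (by simpa [S] using he)

lemma q_le (hX : IsPolyaUrn P X b w) (hb : 2 ≤ b) (hw : 1 ≤ w) (n k : ℕ) :
    P.real {ω | bc b n (fun i => X i ω) = k} ≤ ((b:ℝ) + w - 1) / (b + w + n - 1) := by
  have hb' : (2:ℝ) ≤ b := by exact_mod_cast hb
  have hw' : (1:ℝ) ≤ w := by exact_mod_cast hw
  induction n generalizing k with
  | zero =>
    refine measureReal_le_one.trans ?_
    rw [Nat.cast_zero, add_zero, div_self (by linarith)]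
  | succ n ih =>
    have hn : (0:ℝ) ≤ n := by positivity
    by_cases hk : 1 ≤ k ∧ k ≤ b + n + 1
    · obtain ⟨k, rfl⟩ : ∃ j, k = j+1 := ⟨k-1, by omega⟩
      have mt : ∀ c, MeasurableSet {ω | X n ω = c} := fun c => measurableSet_eq_fun (hX.1 n) measurable_const
      have h1 := step_k hX n _ (mt true) k ((k:ℝ) / (b+w+n)) (fun y hy => by rw [step_true hX, hy])
      have h2 := step_k hX n _ (mt false) (k+1) (((b:ℝ)+w+n-(k+1)) / (b+w+n)) (fun y hy => by
        rw [step_false hX hw]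
        have hs : (bc b n y : ℝ) + wc w n y = b + w + n := by exact_mod_cast bw_add b w n y
        rw [← hs, hy]; push_cast; ring)
      have hsub : {ω | bc b (n+1) (fun i => X i ω) = k+1} ⊆
          ({ω | bc b n (fun i => X i ω) = k} ∩ {ω | X n ω = true}) ∪
          ({ω | bc b n (fun i => X i ω) = k+1} ∩ {ω | X n ω = false}) := by
        intro ω hω
        simp only [Set.mem_union, Set.mem_inter_iff, Set.mem_ofPred_eq] at hω ⊢
        rw [bc_succ] at hω
        cases h : X n ω <;> simp [h] at hω ⊢ <;> omega
      have h3 := (measureReal_mono (μ := P) hsub).trans (measureReal_union_le _ _)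
      rw [h1, h2] at h3
      have hkk : (k:ℝ) ≤ b + n := by exact_mod_cast (by omega : k ≤ b + n)
      have c1 : (0:ℝ) ≤ (k:ℝ) / (b+w+n) := by positivity
      have c2 : (0:ℝ) ≤ ((b:ℝ)+w+n-(k+1)) / (b+w+n) := div_nonneg (by linarith) (by positivity)
      have i1 := mul_le_mul_of_nonneg_left (ih k) c1
      have i2 := mul_le_mul_of_nonneg_left (ih (k+1)) c2
      refine h3.trans ((add_le_add i1 i2).trans (le_of_eq ?_))
      have p1 : (b:ℝ) + w + n ≠ 0 := by positivity
      have p2 : (b:ℝ) + w + n - 1 ≠ 0 := by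
        have : (0:ℝ) < b + w + n - 1 := by linarith
        exact this.ne'
      have p3 : (b:ℝ) + w + ((n+1 : ℕ):ℝ) - 1 = b + w + n := by push_cast; ring
      rw [p3]
      field_simp
      ring
    · have : {ω | bc b (n+1) (fun i => X i ω) = k} = ∅ := by
        ext ω
        simp only [Set.mem_ofPred_eq, Set.mem_empty_iff_false, iff_false]
        have h1 := bw_add b w (n+1) (fun i => X i ω)
        have h2 : w ≤ wc w (n+1) (fun i => X i ω) := by unfold wc; omega
        have h3 : b ≤ bc b (n+1) (fun i => X i ω) := by unfold bc; omega
        omega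
      rw [this, measureReal_empty]
      push_cast
      apply div_nonneg <;> linarith

lemma no_atom (hX : IsPolyaUrn P X b w) (hb : 2 ≤ b) (hw : 1 ≤ w) (Z : Ω → ℝ)
    (hZ : ∀ᵐ ω ∂P, Tendsto (fun n : ℕ => (bc b n (fun i => X i ω) : ℝ) / ((b : ℝ) + w + n))
      atTop (nhds (Z ω))) : P {ω | Z ω = 1/2} = 0 := by
  have hb' : (2:ℝ) ≤ b := by exact_mod_cast hb
  have hw' : (1:ℝ) ≤ w := by exact_mod_cast hw
  have hT : Measurable (fun ω i => X i ω) := measurable_pi_iff.2 hX.1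
  have hf : ∀ n : ℕ, Measurable fun ω => (bc b n (fun i => X i ω) : ℝ) / ((b : ℝ) + w + n) := fun n =>
    (measurable_from_top.comp ((measurable_bc b n).comp hT)).div_const _
  have hin := tendstoInMeasure_of_tendsto_ae (fun n => (hf n).aestronglyMeasurable) hZ
  have key : ∀ δ : ℝ, 0 < δ → P.real {ω | Z ω = 1/2} ≤ 4 * δ * (b + w - 1) := by
    intro δ hδ
    have h1 := (tendstoInMeasure_iff_measureReal_dist.1 hin) δ hδ
    have h2 : Tendsto (fun n : ℕ => ((b:ℝ) + w - 1) * (4 * δ + 1 / ((n:ℝ) + (b + w - 1)))) atTop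
        (nhds (((b:ℝ) + w - 1) * (4 * δ + 0))) := by
      refine (tendsto_const_nhds.add ?_).const_mul _
      have := tendsto_atTop_add_const_right atTop ((b:ℝ)+w-1) tendsto_natCast_atTop_atTop
      simp only [one_div]
      exact this.inv_tendsto_atTop
    have h3 := h1.add h2
    have h4 : 0 + ((b:ℝ) + w - 1) * (4 * δ + 0) = 4 * δ * (b + w - 1) := by ring
    rw [h4] at h3
    refine ge_of_tendsto' h3 fun n => ?_
    have hn : (0:ℝ) ≤ n := by positivity
    set N : ℝ := (b:ℝ) + w + n with hN
    have hNpos : 0 < N := by linarith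
    let K : Finset ℕ := Finset.Icc ⌈N/2 - δ*N⌉₊ ⌊N/2+δ*N⌋₊
    have hsub : {ω | Z ω = 1/2} ⊆ {ω | δ ≤ dist ((bc b n (fun i => X i ω) : ℝ) / N) (Z ω)} ∪
        ⋃ k ∈ K, {ω | bc b n (fun i => X i ω) = k} := by
      intro ω hω
      simp only [Set.mem_ofPred_eq] at hω
      by_cases hd : δ ≤ dist ((bc b n (fun i => X i ω) : ℝ) / N) (Z ω)
      · exact Or.inl hd
      · right
        rw [hω, Real.dist_eq, not_le, abs_lt, lt_sub_iff_add_lt, sub_lt_iff_lt_add, lt_div_iff₀ hNpos,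
          div_lt_iff₀ hNpos] at hd
        simp only [Set.mem_iUnion, Set.mem_ofPred_eq, exists_prop, exists_eq_right', K, Finset.mem_Icc]
        refine ⟨Nat.ceil_le.2 (by linarith), Nat.le_floor (by linarith)⟩
    refine (measureReal_mono hsub).trans ((measureReal_union_le _ _).trans ?_)
    refine add_le_add le_rfl ?_
    refine (measureReal_biUnion_finset_le _ _).trans ?_
    refine (Finset.sum_le_card_nsmul _ _ _ (fun k _ => q_le hX hb hw n k)).trans ?_
    rw [nsmul_eq_mul]
    have hcard : (K.card : ℝ) ≤ 2*δ*N + 1 := by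
      have h5 : (0:ℝ) ≤ N/2 + δ*N := by positivity
      have h6 := Nat.floor_le h5
      have h7 := Nat.le_ceil (N/2 - δ*N)
      rw [Nat.card_Icc]
      rcases le_total ⌈N/2 - δ*N⌉₊ (⌊N/2+δ*N⌋₊ + 1) with h | h
      · rw [Nat.cast_sub h]; push_cast; linarith
      · rw [Nat.sub_eq_zero_of_le h]; push_cast; positivity
    have hM : 0 < N - 1 := by linarith
    have e : (n:ℝ) + (b + w - 1) = N - 1 := by rw [hN]; ring
    have hc : (0:ℝ) ≤ b + w - 1 := by linarith
    rw [e]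
    calc (K.card : ℝ) * (((b:ℝ) + w - 1) / (N - 1)) ≤ (4*δ*(N-1) + 1) * (((b:ℝ) + w - 1) / (N - 1)) := by
          refine mul_le_mul_of_nonneg_right (hcard.trans ?_) (by positivity)
          nlinarith
      _ = _ := by field_simp
  rw [← measureReal_eq_zero_iff]
  by_contra hne
  have hpos : 0 < P.real {ω | Z ω = 1/2} := lt_of_le_of_ne measureReal_nonneg (Ne.symm hne)
  have hc : (0:ℝ) < b + w - 1 := by linarith
  have := key (P.real {ω | Z ω = 1/2} / (8 * (b+w-1))) (by positivity)
  have e : 4 * (P.real {ω | Z ω = 1/2} / (8 * ((b:ℝ)+w-1))) * (b+w-1) = P.real {ω | Z ω = 1/2} / 2 := by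
    have := hc.ne'
    generalize P.real {ω | Z ω = 1/2} = r
    field_simp; ring
  linarith

lemma half_eq (hX : IsPolyaUrn P X b w) (hb : 2 ≤ b) (hw : 1 ≤ w) (Z : Ω → ℝ)
    (hZ : ∀ᵐ ω ∂P, Tendsto (fun n : ℕ => (bc b n (fun i => X i ω) : ℝ) / ((b : ℝ) + w + n))
      atTop (nhds (Z ω))) :
    P {ω | (∃ n, bc b n (fun i => X i ω) = wc w n (fun i => X i ω)) ∧ Z ω < 1/2} =
    P {ω | (∃ n, bc b n (fun i => X i ω) = wc w n (fun i => X i ω)) ∧ 1/2 < Z ω} := by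
  have hT : Measurable (fun ω i => X i ω) := measurable_pi_iff.2 hX.1
  have hF := (measurable_flp b w).comp hT
  let L : (ℕ → Bool) → ℝ := fun x => limsup (fun n : ℕ => (bc b n x : ℝ) / ((b : ℝ) + w + n)) atTop
  have hL : Measurable L := by
    apply Measurable.limsup
    intro n
    exact (measurable_from_top.comp (measurable_bc b n)).div_const _
  let S : Set (ℕ → Bool) := (⋃ n, {x | bc b n x = wc w n x}) ∩ {x | L x < 1/2}
  have hS : MeasurableSet S := (MeasurableSet.iUnion fun n => measurable_E b w n).inter
    (measurableSet_lt hL measurable_const)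
  have h : P.map (fun ω i => X i ω) S = P.map (fun ω => flp b w (fun i => X i ω)) S := by
    rw [map_flp hX (by omega) hw]
  rw [Measure.map_apply hT hS] at h
  have h' := h.trans (Measure.map_apply hF hS)
  convert h' using 1
  · apply measure_congr
    filter_upwards [hZ] with ω hω
    apply propext
    change (_ ∧ _) ↔ (fun i => X i ω) ∈ S
    simp only [S, Set.mem_inter_iff, Set.mem_iUnion, Set.mem_ofPred_eq, L, hω.limsup_eq]
  · apply measure_congr
    filter_upwards [hZ] with ω hω
    apply propext
    change (_ ∧ _) ↔ flp b w (fun i => X i ω) ∈ S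
    simp only [S, Set.mem_inter_iff, Set.mem_iUnion, Set.mem_ofPred_eq, flp_eq_iff]
    apply and_congr_right
    rintro ⟨m, hm⟩
    have : Tendsto (fun n : ℕ => (bc b n (flp b w (fun i => X i ω)) : ℝ) / ((b : ℝ) + w + n))
        atTop (nhds (1 - Z ω)) := by
      refine (hω.const_sub 1).congr' ?_
      filter_upwards [eventually_ge_atTop m] with n hn
      rw [((flp_counts b w n _).1 ⟨m, hn, hm⟩).1]
      have hs : (bc b n (fun i => X i ω) : ℝ) + wc w n (fun i => X i ω) = b + w + n := by
        exact_mod_cast bw_add b w n _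
      have hb' : (2:ℝ) ≤ b := by exact_mod_cast hb
      have : (b:ℝ) + w + n ≠ 0 := by positivity
      field_simp
      linarith
    simp only [L, this.limsup_eq]
    constructor <;> intro h <;> linarith

lemma cross (hbw : w < b) (x : ℕ → Bool) (n : ℕ) (h : bc b n x < wc w n x) :
    ∃ m, bc b m x = wc w m x := by
  by_contra hne
  push Not at hne
  have : ∀ m, wc w m x < bc b m x := by
    intro m
    induction m with
    | zero => simpa [bc_zero, wc_zero] using hbw
    | succ m ih =>
      have := hne (m+1)
      rw [bc_succ, wc_succ] at this ⊢
      cases hx : x m <;> simp [hx] at this ⊢ <;> omega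
  have := this n
  omega

lemma equalization_two_mul (hbw : w < b) (hw : 1 ≤ w) (hX : IsPolyaUrn P X b w) (Z : Ω → ℝ) (hZm : Measurable Z)
    (hZ : ∀ᵐ ω ∂P, Tendsto (fun n : ℕ => (bc b n (fun i => X i ω) : ℝ) / ((b : ℝ) + w + n))
      atTop (nhds (Z ω))) :
    P {ω | ∃ n, bc b n (fun i => X i ω) = wc w n (fun i => X i ω)} = 2 * P {ω | Z ω < 1/2} := by
  have e := half_eq hX (by omega) hw Z hZ
  have h0 := no_atom hX (by omega) hw Z hZ
  have e1 : P {ω | (∃ n, bc b n (fun i => X i ω) = wc w n (fun i => X i ω)) ∧ Z ω < 1/2} =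
      P {ω | Z ω < 1/2} := by
    apply measure_congr
    filter_upwards [hZ] with ω hω
    apply propext
    change (_ ∧ _) ↔ Z ω < 1/2
    refine ⟨fun h => h.2, fun h => ⟨?_, h⟩⟩
    obtain ⟨n, hn⟩ := (hω.eventually (gt_mem_nhds h)).exists
    refine cross hbw _ n ?_
    have hs : (bc b n (fun i => X i ω) : ℝ) + wc w n (fun i => X i ω) = b + w + n := by
      exact_mod_cast bw_add b w n _
    have hw' : (1:ℝ) ≤ w := by exact_mod_cast hw
    rw [div_lt_iff₀ (by positivity)] at hn
    have : (bc b n (fun i => X i ω) : ℝ) < wc w n (fun i => X i ω) := by linarith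
    exact_mod_cast this
  have hm : MeasurableSet {ω | Z ω < 1/2} := measurableSet_lt hZm measurable_const
  rw [← measure_inter_add_sdiff _ hm, two_mul]
  congr 1
  rw [← e1, e]
  apply measure_congr
  have h0' : ∀ᵐ ω ∂P, ¬ (Z ω = 1/2) := by rw [ae_iff]; simpa using h0
  filter_upwards [h0'] with ω hω
  apply propext
  change (_ ∧ ¬ (Z ω < 1/2)) ↔ (_ ∧ _)
  refine and_congr_right fun _ => ?_
  rw [not_lt]
  exact ⟨fun h => lt_of_le_of_ne h (Ne.symm hω), le_of_lt⟩
end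

/-- Splitting the equalization event according to the sign of `μ = 2Z − 1`: both halves
have equal probability, so the equalization probability is `2 P(μ < 0)`. -/
theorem polya_equalization_symmetry {Ω : Type*} [MeasurableSpace Ω] (P : Measure Ω)
    [IsProbabilityMeasure P] (X : ℕ → Ω → Bool) (b w : ℕ)
    (hbw : b > w) (hw : 1 ≤ w) (hX : IsPolyaUrn P X b w)
    (Z : Ω → ℝ) (hZm : Measurable Z)
    (hZ : ∀ᵐ ω ∂P, Tendsto (fun n => (blackCount X b n ω : ℝ) / ((b : ℝ) + w + n))
      atTop (nhds (Z ω))) :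
    P ({ω | ∃ n, blackCount X b n ω = whiteCount X w n ω} ∩ {ω | 2 * Z ω - 1 < 0}) =
        P ({ω | ∃ n, blackCount X b n ω = whiteCount X w n ω} ∩ {ω | 2 * Z ω - 1 > 0}) ∧
      P {ω | ∃ n, blackCount X b n ω = whiteCount X w n ω} =
        2 * P {ω | 2 * Z ω - 1 < 0} := by
  have e1 : {ω | 2 * Z ω - 1 < 0} = {ω | Z ω < 1/2} := by
    ext ω
    simp only [Set.mem_ofPred_eq]
    constructor <;> intro h <;> linarith
  have e2 : {ω | 2 * Z ω - 1 > 0} = {ω | 1/2 < Z ω} := by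
    ext ω
    simp only [Set.mem_ofPred_eq]
    constructor <;> intro h <;> linarith
  rw [e1, e2]
  exact ⟨half_eq hX (by omega) hw Z hZ, equalization_two_mul hbw hw hX Z hZm hZ⟩
end
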